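/- Let p, q, r ≥ 2 be integers with 1/p + 1/q + 1/r < 1 and let f = x^p + y^q + z^r + xyz ∈ ℂ[[x,y,z]] (a hyperbolic T_{p,q,r}-singularity). Then μ(f) = dim_ℂ ℂ[[x,y,z]]/(p·x^{p−1}+yz, q·y^{q−1}+xz, r·z^{r−1}+xy) = p+q+r−1, and τ(f) = dim_ℂ ℂ[[x,y,z]]/(f, p·x^{p−1}+yz, q·y^{q−1}+xz, r·z^{r−1}+xy) = p+q+r−2. -/

import Mathlib

set_option linter.unusedSimpArgs false

structure ClosedFacts {A : Type*} [CommRing A] [Algebra ℂ A] (x y z : A) (P Q R : A) : Prop where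
  zx : x * (x * y * z) = 0
  zy : y * (x * y * z) = 0
  zz : z * (x * y * z) = 0
  cl : ∀ V : Submodule ℂ A, (∀ v ∈ V, P * v ∈ V) → (∀ v ∈ V, Q * v ∈ V) → (∀ v ∈ V, R * v ∈ V) →
    (∀ n, x ^ n ∈ V) → (∀ n, y ^ n ∈ V) → (∀ n, z ^ n ∈ V) →
    ∀ n, x * y ^ n ∈ V ∧ x * z ^ n ∈ V ∧ y * x ^ n ∈ V ∧ y * z ^ n ∈ V ∧ z * x ^ n ∈ V ∧ z * y ^ n ∈ V

section
variable {A : Type*} [CommRing A] [Algebra ℂ A] {x y z P Q R : A}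

lemma caseA_facts (p q r : ℕ) (hloc : ∀ e a : A, e = e * (x * a) → e = 0)
    (h1 : P * x ^ (p + 3) + y * z = 0) (h2 : Q * y ^ (q + 2) + x * z = 0)
    (h3 : R * z ^ (r + 2) + x * y = 0) : ClosedFacts x y z P Q R := by
  have k1 : x ^ 2 * y = 0 := hloc _ (-P*Q*R * x ^ p * y ^ q * z ^ r) (by
    linear_combination x * h3 - R * z ^ (r+1) * h2 + Q * R * y ^ (q+1) * z ^ r * h1)
  have k2 : x * y ^ 2 = 0 := hloc _ (-P*Q*R * x ^ p * y ^ q * z ^ r) (by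
    linear_combination y * h3 - R * z ^ (r+1) * h1 + P * R * x ^ (p+2) * z ^ r * h2)
  have k3 : x ^ 2 * z = 0 := hloc _ (-P*Q*R * x ^ p * y ^ q * z ^ r) (by
    linear_combination x * h2 - Q * y ^ (q+1) * h3 + Q * R * z ^ (r+1) * y ^ q * h1)
  have k4 : x * z ^ 2 = 0 := hloc _ (-P*Q*R * x ^ p * y ^ q * z ^ r) (by
    linear_combination z * h2 - Q * y ^ (q+1) * h1 + P * Q * x ^ (p+2) * y ^ q * h3)
  have k5 : y ^ 2 * z = 0 := hloc _ (-P*Q*R * x ^ p * y ^ q * z ^ r) (by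
    linear_combination y * h1 - P * x ^ (p+2) * h3 + P * R * z ^ (r+1) * x ^ (p+1) * h2)
  have k6 : y * z ^ 2 = 0 := hloc _ (-P*Q*R * x ^ p * y ^ q * z ^ r) (by
    linear_combination z * h1 - P * x ^ (p+2) * h2 + P * Q * y ^ (q+1) * x ^ (p+1) * h3)
  refine ⟨by linear_combination z * k1, by linear_combination z * k2, by linear_combination y * k4, ?_⟩
  intro V hP hQ hR hx hy hz n
  have m1 : x * y ∈ V := by
    rw [show x * y = -(R * z ^ (r+2)) by linear_combination h3]; exact V.neg_mem (hR _ (hz _))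
  have m2 : x * z ∈ V := by
    rw [show x * z = -(Q * y ^ (q+2)) by linear_combination h2]; exact V.neg_mem (hQ _ (hy _))
  have m3 : y * z ∈ V := by
    rw [show y * z = -(P * x ^ (p+3)) by linear_combination h1]; exact V.neg_mem (hP _ (hx _))
  match n with
  | 0 =>
    have a1 := hx 1
    have a2 := hy 1
    have a3 := hz 1
    simp only [pow_one] at a1 a2 a3
    simp only [pow_zero, mul_one]
    exact ⟨a1, a1, a2, a2, a3, a3⟩
  | 1 =>
    simp only [pow_one]
    refine ⟨m1, m2, ?_, m3, ?_, ?_⟩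
    · rwa [mul_comm]
    · rwa [mul_comm]
    · rwa [mul_comm]
  | n + 2 =>
    refine ⟨?_, ?_, ?_, ?_, ?_, ?_⟩
    · rw [show x * y ^ (n+2) = 0 by linear_combination y ^ n * k2]; exact V.zero_mem
    · rw [show x * z ^ (n+2) = 0 by linear_combination z ^ n * k4]; exact V.zero_mem
    · rw [show y * x ^ (n+2) = 0 by linear_combination x ^ n * k1]; exact V.zero_mem
    · rw [show y * z ^ (n+2) = 0 by linear_combination z ^ n * k6]; exact V.zero_mem
    · rw [show z * x ^ (n+2) = 0 by linear_combination x ^ n * k3]; exact V.zero_mem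
    · rw [show z * y ^ (n+2) = 0 by linear_combination y ^ n * k5]; exact V.zero_mem

lemma caseB_facts (p q : ℕ) (hloc : ∀ e a : A, e = e * (x * a) → e = 0)
    (h1 : P * x ^ (p + 4) + y * z = 0) (h2 : Q * y ^ (q + 3) + x * z = 0)
    (h3 : R * z + x * y = 0) : ClosedFacts x y z P Q R := by
  have k1 : x ^ 3 * y = 0 := hloc _ (P*Q*R^2 * x ^ p * y ^ q) (by
    linear_combination x^2 * h3 - R * x * h2 + Q * R * y ^ (q+2) * h3 - Q * R^2 * y^(q+1) * h1)
  have k2 : x * y ^ 3 = 0 := hloc _ (P*Q*R^2 * x ^ p * y ^ q) (by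
    linear_combination y^2 * h3 - R * y * h1 + P * R * x ^ (p+3) * h3 - P * R^2 * x^(p+2) * h2)
  have k3 : x ^ 2 * z = 0 := by
    linear_combination x * h2 - Q * y ^ q * k2
  have k5 : y ^ 2 * z = 0 := by
    linear_combination y * h1 - P * x ^ (p+1) * k1
  have k4 : x * z ^ 2 = 0 := by
    linear_combination z * h2 - Q * y ^ (q+1) * k5
  have k6 : y * z ^ 2 = 0 := by
    linear_combination z * h1 - P * x ^ (p+2) * k3
  refine ⟨by linear_combination y * k3, by linear_combination x * k5, by linear_combination y * k4, ?_⟩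
  intro V hP hQ hR hx hy hz n
  have m1 : x * y ∈ V := by
    rw [show x * y = -(R * z ^ 1) by linear_combination h3]; exact V.neg_mem (hR _ (hz _))
  have m2 : x * z ∈ V := by
    rw [show x * z = -(Q * y ^ (q+3)) by linear_combination h2]; exact V.neg_mem (hQ _ (hy _))
  have m3 : y * z ∈ V := by
    rw [show y * z = -(P * x ^ (p+4)) by linear_combination h1]; exact V.neg_mem (hP _ (hx _))
  have m4 : x * y ^ 2 ∈ V := by
    rw [show x * y ^ 2 = -(R * (y * z)) by linear_combination y * h3]; exact V.neg_mem (hR _ m3)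
  have m5 : y * x ^ 2 ∈ V := by
    rw [show y * x ^ 2 = -(R * (x * z)) by linear_combination x * h3]; exact V.neg_mem (hR _ m2)
  match n with
  | 0 =>
    have a1 := hx 1
    have a2 := hy 1
    have a3 := hz 1
    simp only [pow_one] at a1 a2 a3
    simp only [pow_zero, mul_one]
    exact ⟨a1, a1, a2, a2, a3, a3⟩
  | 1 =>
    simp only [pow_one]
    refine ⟨m1, m2, ?_, m3, ?_, ?_⟩
    · rwa [mul_comm]
    · rwa [mul_comm]
    · rwa [mul_comm]
  | n + 2 =>
    refine ⟨?_, ?_, ?_, ?_, ?_, ?_⟩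
    · cases n with
      | zero => exact m4
      | succ n => rw [show x * y ^ (n+1+2) = 0 by linear_combination y ^ n * k2]; exact V.zero_mem
    · rw [show x * z ^ (n+2) = 0 by linear_combination z ^ n * k4]; exact V.zero_mem
    · cases n with
      | zero => exact m5
      | succ n => rw [show y * x ^ (n+1+2) = 0 by linear_combination x ^ n * k1]; exact V.zero_mem
    · rw [show y * z ^ (n+2) = 0 by linear_combination z ^ n * k6]; exact V.zero_mem
    · rw [show z * x ^ (n+2) = 0 by linear_combination x ^ n * k3]; exact V.zero_mem
    · rw [show z * y ^ (n+2) = 0 by linear_combination y ^ n * k5]; exact V.zero_mem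

lemma caseC_facts (p : ℕ) (hloc : ∀ e a : A, e = e * (x * a) → e = 0)
    (h1 : P * x ^ (p + 6) + y * z = 0) (h2 : Q * y ^ 2 + x * z = 0)
    (h3 : R * z + x * y = 0) : ClosedFacts x y z P Q R := by
  have k0 : x ^ 3 * y ^ 2 = Q * R * (x * y ^ 3) := by
    linear_combination x ^ 2 * y * h3 - R * x * y * h2
  have k2 : x * y ^ 3 = 0 := hloc _ (P*Q^2*R^3 * x ^ p) (by
    linear_combination y^2 * h3 - R * y * h1 + P * R * x ^ (p+5) * h3 - P * R^2 * x^(p+4) * h2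
      + P * Q * R^2 * x ^ (p+1) * k0)
  have k1 : x ^ (p + 6) * y = 0 := by
    linear_combination x^(p+5) * h3 - R * x^(p+4) * h2 + Q * R * x ^ (p+1) * k0
      + Q^2 * R^2 * x^(p+1) * k2
  have k5 : y ^ 2 * z = 0 := by
    linear_combination y * h1 - P * k1
  have k4 : x * z ^ 2 = 0 := by
    linear_combination z * h2 - Q * k5
  have k7 : x ^ 3 * y ^ 2 = 0 := by rw [k0, k2, mul_zero]
  have k6 : y * z ^ 2 = 0 := by
    linear_combination z * h1 - P * x ^ (p+5) * h2 + P * Q * x ^ (p+2) * k7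
  refine ⟨by linear_combination x * y * h2 - Q * k2, by linear_combination x * k5,
    by linear_combination y * k4, ?_⟩
  intro V hP hQ hR hx hy hz n
  have m1 : x * y ∈ V := by
    rw [show x * y = -(R * z ^ 1) by linear_combination h3]; exact V.neg_mem (hR _ (hz _))
  have m2 : x * z ∈ V := by
    rw [show x * z = -(Q * y ^ 2) by linear_combination h2]; exact V.neg_mem (hQ _ (hy _))
  have m3 : y * z ∈ V := by
    rw [show y * z = -(P * x ^ (p+6)) by linear_combination h1]; exact V.neg_mem (hP _ (hx _))
  have m4 : x * y ^ 2 ∈ V := by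
    rw [show x * y ^ 2 = -(R * (y * z)) by linear_combination y * h3]; exact V.neg_mem (hR _ m3)
  have m5 : y * x ^ 2 ∈ V := by
    rw [show y * x ^ 2 = -(R * (x * z)) by linear_combination x * h3]; exact V.neg_mem (hR _ m2)
  have m6 : ∀ n, z * x ^ (n+2) ∈ V := by
    intro n
    rw [show z * x ^ (n+2) = -(P * (Q * (R * x ^ (p + 6 + n)))) by
      linear_combination x ^ (n+1) * h2 - Q * x ^ n * y * h3 + Q * R * x ^ n * h1]
    exact V.neg_mem (hP _ (hQ _ (hR _ (hx _))))
  match n with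
  | 0 =>
    have a1 := hx 1
    have a2 := hy 1
    have a3 := hz 1
    simp only [pow_one] at a1 a2 a3
    simp only [pow_zero, mul_one]
    exact ⟨a1, a1, a2, a2, a3, a3⟩
  | 1 =>
    simp only [pow_one]
    refine ⟨m1, m2, ?_, m3, ?_, ?_⟩
    · rwa [mul_comm]
    · rwa [mul_comm]
    · rwa [mul_comm]
  | n + 2 =>
    refine ⟨?_, ?_, ?_, ?_, ?_, ?_⟩
    · cases n with
      | zero => exact m4
      | succ n => rw [show x * y ^ (n+1+2) = 0 by linear_combination y ^ n * k2]; exact V.zero_mem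
    · rw [show x * z ^ (n+2) = 0 by linear_combination z ^ n * k4]; exact V.zero_mem
    · cases n with
      | zero => exact m5
      | succ n =>
        rw [show y * x ^ (n+1+2) = -(R * (z * x ^ (n+2))) by linear_combination x ^ (n+2) * h3]
        exact V.neg_mem (hR _ (m6 _))
    · rw [show y * z ^ (n+2) = 0 by linear_combination z ^ n * k6]; exact V.zero_mem
    · exact m6 n
    · rw [show z * y ^ (n+2) = 0 by linear_combination y ^ n * k5]; exact V.zero_mem
end

structure Functionals {A : Type*} [CommRing A] [Algebra ℂ A] (x y z : A) (p q r : ℕ) : Prop where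
  fx : ∀ n, n + 1 < p → ∃ φ : A →ₗ[ℂ] ℂ, (∀ m, φ (x ^ m) = if m = n then 1 else 0) ∧
    (∀ m, φ (y ^ (m + 1)) = 0) ∧ (∀ m, φ (z ^ (m + 1)) = 0)
  fy : ∀ n, n + 2 < q → ∃ φ : A →ₗ[ℂ] ℂ, (∀ m, φ (x ^ m) = 0) ∧
    (∀ m, φ (y ^ (m + 1)) = if m = n then 1 else 0) ∧ (∀ m, φ (z ^ (m + 1)) = 0)
  fz : ∀ n, n + 2 < r → ∃ φ : A →ₗ[ℂ] ℂ, (∀ m, φ (x ^ m) = 0) ∧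
    (∀ m, φ (y ^ (m + 1)) = 0) ∧ (∀ m, φ (z ^ (m + 1)) = if m = n then 1 else 0)
  fL : ∃ L : A →ₗ[ℂ] ℂ, L (x ^ p) ≠ 0 ∧ L (y ^ q) ≠ 0 ∧ L (z ^ r) ≠ 0 ∧ L (x ^ (p + 1)) = 0 ∧
    L (x * y ^ (q - 1)) = 0 ∧ L (x * z ^ (r - 1)) = 0 ∧ L (y * x ^ p) = 0 ∧
    L (y * z ^ (r - 1)) = 0 ∧ L (z * x ^ p) = 0

section
variable {A : Type*} [CommRing A] [Algebra ℂ A] {x y z : A}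

noncomputable def Phi (x y z : A) (p q r : ℕ) :
    ((Fin (p + 1) → ℂ) × (Fin (q - 1) → ℂ) × (Fin (r - 1) → ℂ)) →ₗ[ℂ] A :=
  (Fintype.linearCombination ℂ (fun i : Fin (p + 1) => x ^ (i : ℕ))).coprod
    ((Fintype.linearCombination ℂ (fun i : Fin (q - 1) => y ^ ((i : ℕ) + 1))).coprod
      (Fintype.linearCombination ℂ (fun i : Fin (r - 1) => z ^ ((i : ℕ) + 1))))

lemma Phi_apply (p q r : ℕ) (a : Fin (p + 1) → ℂ) (b : Fin (q - 1) → ℂ) (d : Fin (r - 1) → ℂ) :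
    Phi x y z p q r (a, b, d) = ∑ i, a i • x ^ (i : ℕ) + (∑ i, b i • y ^ ((i : ℕ) + 1)
      + ∑ i, d i • z ^ ((i : ℕ) + 1)) := by
  simp [Phi, Fintype.linearCombination_apply]

lemma Phi_inj (p q r : ℕ) (hp : 2 ≤ p) (hq : 2 ≤ q) (hr : 2 ≤ r)
    (F : Functionals x y z p q r) : Function.Injective (Phi x y z p q r) := by
  rw [injective_iff_map_eq_zero]
  rintro ⟨a, b, d⟩ h
  rw [Phi_apply] at h
  have key : ∀ φ : A →ₗ[ℂ] ℂ, ∑ i, a i * φ (x ^ (i : ℕ)) + (∑ i, b i * φ (y ^ ((i : ℕ) + 1))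
      + ∑ i, d i * φ (z ^ ((i : ℕ) + 1))) = 0 := by
    intro φ
    have := congrArg φ h
    simpa [map_sum] using this
  have ha : ∀ i : Fin (p + 1), (i : ℕ) + 1 < p → a i = 0 := by
    intro i hi
    obtain ⟨φ, h1, h2, h3⟩ := F.fx i hi
    have := key φ
    simpa [h1, h2, h3, Fin.val_inj] using this
  have hb : ∀ i : Fin (q - 1), (i : ℕ) + 2 < q → b i = 0 := by
    intro i hi
    obtain ⟨φ, h1, h2, h3⟩ := F.fy i hi
    have := key φ
    simpa [h1, h2, h3, Fin.val_inj] using this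
  have hd : ∀ i : Fin (r - 1), (i : ℕ) + 2 < r → d i = 0 := by
    intro i hi
    obtain ⟨φ, h1, h2, h3⟩ := F.fz i hi
    have := key φ
    simpa [h1, h2, h3, Fin.val_inj] using this
  obtain ⟨L, Lx, Ly, Lz, Lx1, Lxy, Lxz, Lyx, Lyz, Lzx⟩ := F.fL
  have ha1 : a ⟨p - 1, by omega⟩ = 0 := by
    have := key (L ∘ₗ LinearMap.mulLeft ℂ x)
    simp only [LinearMap.comp_apply, LinearMap.mulLeft_apply, ← pow_succ'] at this
    rw [Finset.sum_eq_single (⟨p - 1, by omega⟩ : Fin (p + 1)), Finset.sum_eq_zero,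
      Finset.sum_eq_zero] at this
    · simp only [show p - 1 + 1 = p by omega, add_zero] at this
      exact (mul_eq_zero.mp this).resolve_right Lx
    · intro i _
      by_cases hi : (i : ℕ) + 2 < r
      · simp [hd i hi]
      · rw [show (i : ℕ) + 1 = r - 1 by omega, Lxz, mul_zero]
    · intro i _
      by_cases hi : (i : ℕ) + 2 < q
      · simp [hb i hi]
      · rw [show (i : ℕ) + 1 = q - 1 by omega, Lxy, mul_zero]
    · intro i _ hi
      by_cases hi' : (i : ℕ) + 1 < p
      · simp [ha i hi']
      · have : (i : ℕ) ≠ p - 1 := fun h => hi (Fin.ext h)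
        rw [show (i : ℕ) = p by omega, Lx1, mul_zero]
    · simp
  have ha2 : ∀ i : Fin (p + 1), (i : ℕ) ≠ p → a i = 0 := by
    intro i hi
    by_cases hi' : (i : ℕ) + 1 < p
    · exact ha i hi'
    · rw [← ha1]; congr 1; ext; simp; omega
  have hb1 : b ⟨q - 2, by omega⟩ = 0 := by
    have := key (L ∘ₗ LinearMap.mulLeft ℂ y)
    simp only [LinearMap.comp_apply, LinearMap.mulLeft_apply, ← pow_succ'] at this
    rw [Finset.sum_eq_zero, Finset.sum_eq_single (⟨q - 2, by omega⟩ : Fin (q - 1)),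
      Finset.sum_eq_zero] at this
    · simp only [show q - 2 + 1 + 1 = q by omega, add_zero, zero_add] at this
      exact (mul_eq_zero.mp this).resolve_right Ly
    · intro i _
      by_cases hi : (i : ℕ) + 2 < r
      · simp [hd i hi]
      · rw [show (i : ℕ) + 1 = r - 1 by omega, Lyz, mul_zero]
    · intro i _ hi
      have : (i : ℕ) ≠ q - 2 := fun h => hi (Fin.ext h)
      rw [hb i (by omega), zero_mul]
    · simp
    · intro i _
      by_cases hi' : (i : ℕ) = p
      · rw [hi', Lyx, mul_zero]
      · rw [ha2 i hi', zero_mul]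
  have hb2 : ∀ i, b i = 0 := by
    intro i
    by_cases hi' : (i : ℕ) + 2 < q
    · exact hb i hi'
    · rw [← hb1]; congr 1; ext; simp; omega
  have hd1 : d ⟨r - 2, by omega⟩ = 0 := by
    have := key (L ∘ₗ LinearMap.mulLeft ℂ z)
    simp only [LinearMap.comp_apply, LinearMap.mulLeft_apply, ← pow_succ', hb2, zero_mul,
      Finset.sum_const_zero] at this
    rw [Finset.sum_eq_zero, Finset.sum_eq_single (⟨r - 2, by omega⟩ : Fin (r - 1))] at this
    · simp only [show r - 2 + 1 + 1 = r by omega, zero_add] at this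
      exact (mul_eq_zero.mp this).resolve_right Lz
    · intro i _ hi
      have : (i : ℕ) ≠ r - 2 := fun h => hi (Fin.ext h)
      rw [hd i (by omega), zero_mul]
    · simp
    · intro i _
      by_cases hi' : (i : ℕ) = p
      · rw [hi', Lzx, mul_zero]
      · rw [ha2 i hi', zero_mul]
  have hd2 : ∀ i, d i = 0 := by
    intro i
    by_cases hi' : (i : ℕ) + 2 < r
    · exact hd i hi'
    · rw [← hd1]; congr 1; ext; simp; omega
  have ha3 : a ⟨p, by omega⟩ = 0 := by
    have := key L
    simp only [hb2, hd2, zero_mul, Finset.sum_const_zero, add_zero] at this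
    rw [Finset.sum_eq_single (⟨p, by omega⟩ : Fin (p + 1))] at this
    · exact (mul_eq_zero.mp this).resolve_right Lx
    · intro i _ hi
      rw [ha2 i (fun h => hi (Fin.ext h)), zero_mul]
    · simp
  refine Prod.ext ?_ (Prod.ext (funext hb2) (funext hd2))
  funext i
  by_cases hi' : (i : ℕ) = p
  · rw [show i = ⟨p, by omega⟩ from Fin.ext hi']; exact ha3
  · exact ha2 i hi'

lemma Phi_surj (p q r : ℕ) (hp : 2 ≤ p) (hq : 2 ≤ q) (hr : 2 ≤ r)
    (h1 : (p : A) * x ^ (p - 1) + y * z = 0) (h2 : (q : A) * y ^ (q - 1) + x * z = 0)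
    (h3 : (r : A) * z ^ (r - 1) + x * y = 0) (C : ClosedFacts x y z (p : A) (q : A) (r : A))
    (hgen : ∀ V : Submodule ℂ A, 1 ∈ V → (∀ v ∈ V, x * v ∈ V) → (∀ v ∈ V, y * v ∈ V) →
      (∀ v ∈ V, z * v ∈ V) → V = ⊤) : Function.Surjective (Phi x y z p q r) := by
  obtain ⟨p, rfl⟩ := Nat.exists_eq_add_of_le' hp
  obtain ⟨q, rfl⟩ := Nat.exists_eq_add_of_le' hq
  obtain ⟨r, rfl⟩ := Nat.exists_eq_add_of_le' hr
  rw [← LinearMap.range_eq_top]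
  set V := LinearMap.range (Phi x y z (p+2) (q+2) (r+2)) with hV
  have hnat : ∀ n : ℕ, ∀ v ∈ V, (n : A) * v ∈ V := by
    intro n v hv
    rw [← nsmul_eq_mul]; exact nsmul_mem hv n
  have hdiv : ∀ n : ℕ, ∀ v, ((n + 2 : ℕ) : A) * v ∈ V → v ∈ V := by
    intro n v hv
    have h := V.smul_mem (((n + 2 : ℕ) : ℂ)⁻¹) hv
    rw [← nsmul_eq_mul, ← Nat.cast_smul_eq_nsmul ℂ, smul_smul, inv_mul_cancel₀, one_smul] at h
    · exact h
    · exact Nat.cast_ne_zero.mpr (by omega)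
  have hzero : ∀ n : ℕ, ∀ v, ((n + 2 : ℕ) : A) * v = 0 → v = 0 := by
    intro n v hv
    have h := congrArg (fun w => (((n + 2 : ℕ) : ℂ)⁻¹) • w) hv
    rw [← nsmul_eq_mul, ← Nat.cast_smul_eq_nsmul ℂ, smul_smul, inv_mul_cancel₀, one_smul,
      smul_zero] at h
    · exact h
    · exact Nat.cast_ne_zero.mpr (by omega)
  simp only [show p + 2 - 1 = p + 1 by omega, show q + 2 - 1 = q + 1 by omega,
    show r + 2 - 1 = r + 1 by omega] at h1 h2 h3
  have hx0 : ∀ n, n ≤ p + 2 → x ^ n ∈ V := by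
    intro n hn
    refine ⟨(Pi.single ⟨n, by omega⟩ 1, 0, 0), ?_⟩
    rw [Phi_apply]
    simp [Pi.single_apply, ite_smul]
  have hxn : ∀ n, x ^ n ∈ V := by
    intro n
    by_cases hn : n ≤ p + 2
    · exact hx0 n hn
    · obtain ⟨k, rfl⟩ := Nat.exists_eq_add_of_le' (show p + 3 ≤ n by omega)
      rw [hzero p (x ^ (k + (p + 3))) (by linear_combination x ^ (k+2) * h1 - x^k * C.zx)]
      exact V.zero_mem
  have hs : x * y * z ∈ V := by
    rw [show x * y * z = -(((p + 2 : ℕ) : A) * x ^ (p + 2)) by linear_combination x * h1]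
    exact V.neg_mem (hnat _ _ (hxn _))
  have hyn : ∀ n, y ^ n ∈ V := by
    intro n
    by_cases hn : n ≤ q + 1
    · rcases n with _ | n
      · simpa using hxn 0
      · refine ⟨(0, Pi.single ⟨n, by omega⟩ 1, 0), ?_⟩
        rw [Phi_apply]
        simp [Pi.single_apply, ite_smul]
    · by_cases hn' : n = q + 2
      · subst hn'
        apply hdiv q
        rw [show ((q + 2 : ℕ) : A) * y ^ (q + 2) = -(x * y * z) by linear_combination y * h2]
        exact V.neg_mem hs
      · obtain ⟨k, rfl⟩ := Nat.exists_eq_add_of_le' (show q + 3 ≤ n by omega)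
        rw [hzero q (y ^ (k + (q + 3))) (by linear_combination y ^ (k+2) * h2 - y^k * C.zy)]
        exact V.zero_mem
  have hzn : ∀ n, z ^ n ∈ V := by
    intro n
    by_cases hn : n ≤ r + 1
    · rcases n with _ | n
      · simpa using hxn 0
      · refine ⟨(0, 0, Pi.single ⟨n, by omega⟩ 1), ?_⟩
        rw [Phi_apply]
        simp [Pi.single_apply, ite_smul]
    · by_cases hn' : n = r + 2
      · subst hn'
        apply hdiv r
        rw [show ((r + 2 : ℕ) : A) * z ^ (r + 2) = -(x * y * z) by linear_combination z * h3]
        exact V.neg_mem hs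
      · obtain ⟨k, rfl⟩ := Nat.exists_eq_add_of_le' (show r + 3 ≤ n by omega)
        rw [hzero r (z ^ (k + (r + 3))) (by linear_combination z ^ (k+2) * h3 - z^k * C.zz)]
        exact V.zero_mem
  have cl := C.cl V (hnat _) (hnat _) (hnat _) hxn hyn hzn
  have stab : ∀ w : A, (∀ n, w * x ^ n ∈ V) → (∀ n, w * y ^ n ∈ V) → (∀ n, w * z ^ n ∈ V) →
      ∀ v ∈ V, w * v ∈ V := by
    rintro w wx wy wz v ⟨⟨a, b, d⟩, rfl⟩
    rw [Phi_apply]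
    simp only [mul_add, Finset.mul_sum, mul_smul_comm]
    exact V.add_mem (V.sum_mem fun i _ => V.smul_mem _ (wx _))
      (V.add_mem (V.sum_mem fun i _ => V.smul_mem _ (wy _))
        (V.sum_mem fun i _ => V.smul_mem _ (wz _)))
  apply hgen
  · simpa using hxn 0
  · exact stab x (fun n => by rw [← pow_succ']; exact hxn _) (fun n => (cl n).1)
      (fun n => (cl n).2.1)
  · exact stab y (fun n => (cl n).2.2.1) (fun n => by rw [← pow_succ']; exact hyn _)
      (fun n => (cl n).2.2.2.1)
  · exact stab z (fun n => (cl n).2.2.2.2.1) (fun n => (cl n).2.2.2.2.2)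
      (fun n => by rw [← pow_succ']; exact hzn _)

lemma gen_of_dec (hdec : ∀ g : A, ∃ (t : ℂ) (g1 g2 g3 : A),
      g = algebraMap ℂ A t + x * g1 + y * g2 + z * g3)
    (nx : IsNilpotent x) (ny : IsNilpotent y) (nz : IsNilpotent z)
    (V : Submodule ℂ A) (h1 : 1 ∈ V) (hx : ∀ v ∈ V, x * v ∈ V) (hy : ∀ v ∈ V, y * v ∈ V)
    (hz : ∀ v ∈ V, z * v ∈ V) : V = ⊤ := by
  set M : Ideal A := Ideal.span {x, y, z} with hM
  have hfg : M.FG := Submodule.fg_span (by simp)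
  have hnil : IsNilpotent M := by
    rw [Ideal.FG.isNilpotent_iff_le_nilradical hfg, hM, Ideal.span_le]
    rintro w (rfl | rfl | rfl) <;> simpa [mem_nilradical]
  obtain ⟨N, hN⟩ := hnil
  have xM : x ∈ M := Ideal.subset_span (by simp)
  have yM : y ∈ M := Ideal.subset_span (by simp)
  have zM : z ∈ M := Ideal.subset_span (by simp)
  have main : ∀ n, ∀ g : A, ∃ v ∈ V, g - v ∈ M ^ n := by
    intro n
    induction n with
    | zero => intro g; exact ⟨0, V.zero_mem, by simp⟩
    | succ n ih =>
      intro g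
      obtain ⟨t, g1, g2, g3, rfl⟩ := hdec g
      obtain ⟨v1, hv1, k1⟩ := ih g1
      obtain ⟨v2, hv2, k2⟩ := ih g2
      obtain ⟨v3, hv3, k3⟩ := ih g3
      refine ⟨algebraMap ℂ A t + x * v1 + y * v2 + z * v3, ?_, ?_⟩
      · refine V.add_mem (V.add_mem (V.add_mem ?_ (hx _ hv1)) (hy _ hv2)) (hz _ hv3)
        rw [Algebra.algebraMap_eq_smul_one]; exact V.smul_mem _ h1
      · rw [pow_succ']
        have := Ideal.add_mem _ (Ideal.add_mem _ (Ideal.mul_mem_mul xM k1)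
          (Ideal.mul_mem_mul yM k2)) (Ideal.mul_mem_mul zM k3)
        convert this using 1
        ring
  rw [eq_top_iff]
  intro g _
  obtain ⟨v, hv, k⟩ := main N g
  rw [hN] at k
  have : g = v := by simpa [sub_eq_zero] using k
  rwa [this]

end

/-- Abstract data: a local `ℂ`-algebra with three coordinates and coefficient functionals. -/
structure CoordSys (R : Type*) [CommRing R] [Algebra ℂ R] (x y z : R) where
  c : ℕ → ℕ → ℕ → R →ₗ[ℂ] ℂ
  c_one : ∀ a b d, c a b d 1 = if a = 0 ∧ b = 0 ∧ d = 0 then 1 else 0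
  cx : ∀ a b d g, c (a + 1) b d (x * g) = c a b d g
  cx0 : ∀ b d g, c 0 b d (x * g) = 0
  cy : ∀ a b d g, c a (b + 1) d (y * g) = c a b d g
  cy0 : ∀ a d g, c a 0 d (y * g) = 0
  cz : ∀ a b d g, c a b (d + 1) (z * g) = c a b d g
  cz0 : ∀ a b g, c a b 0 (z * g) = 0
  dec : ∀ g : R, ∃ (t : ℂ) (g1 g2 g3 : R), g = algebraMap ℂ R t + x * g1 + y * g2 + z * g3
  ux : ∀ a, IsUnit (1 - x * a)
  uy : ∀ a, IsUnit (1 - y * a)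
  uz : ∀ a, IsUnit (1 - z * a)

namespace CoordSys
variable {R : Type*} [CommRing R] [Algebra ℂ R] {x y z : R} (S : CoordSys R x y z)

def swap12 : CoordSys R y x z where
  c a b d := S.c b a d
  c_one a b d := by rw [S.c_one]; congr 1; simp only [eq_iff_iff]; tauto
  cx a b d g := S.cy b a d g
  cx0 b d g := S.cy0 b d g
  cy a b d g := S.cx b a d g
  cy0 a d g := S.cx0 a d g
  cz a b d g := S.cz b a d g
  cz0 a b g := S.cz0 b a g
  dec g := by
    obtain ⟨t, g1, g2, g3, h⟩ := S.dec g
    exact ⟨t, g2, g1, g3, by rw [h]; ring⟩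
  ux := S.uy
  uy := S.ux
  uz := S.uz

def swap23 : CoordSys R x z y where
  c a b d := S.c a d b
  c_one a b d := by rw [S.c_one]; congr 1; simp only [eq_iff_iff]; tauto
  cx a b d g := S.cx a d b g
  cx0 b d g := S.cx0 d b g
  cy a b d g := S.cz a d b g
  cy0 a d g := S.cz0 a d g
  cz a b d g := S.cy a d b g
  cz0 a b g := S.cy0 a b g
  dec g := by
    obtain ⟨t, g1, g2, g3, h⟩ := S.dec g
    exact ⟨t, g1, g3, g2, by rw [h]; ring⟩
  ux := S.ux
  uy := S.uz
  uz := S.uy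

lemma cxp (n a b d : ℕ) (g : R) : S.c a b d (x ^ n * g) = if n ≤ a then S.c (a - n) b d g else 0 := by
  induction n generalizing a with
  | zero => simp
  | succ n ih =>
    rw [pow_succ', mul_assoc]
    cases a with
    | zero => simp [S.cx0]
    | succ a => simp [S.cx, ih]

lemma cyp (n a b d : ℕ) (g : R) : S.c a b d (y ^ n * g) = if n ≤ b then S.c a (b - n) d g else 0 :=
  S.swap12.cxp n b a d g

lemma czp (n a b d : ℕ) (g : R) : S.c a b d (z ^ n * g) = if n ≤ d then S.c a b (d - n) g else 0 :=
  S.swap23.cyp n a d b g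

lemma cx1 (a b d : ℕ) (g : R) : S.c a b d (x * g) = if 1 ≤ a then S.c (a - 1) b d g else 0 := by
  simpa using S.cxp 1 a b d g
lemma cy1 (a b d : ℕ) (g : R) : S.c a b d (y * g) = if 1 ≤ b then S.c a (b - 1) d g else 0 := by
  simpa using S.cyp 1 a b d g
lemma cz1 (a b d : ℕ) (g : R) : S.c a b d (z * g) = if 1 ≤ d then S.c a b (d - 1) g else 0 := by
  simpa using S.czp 1 a b d g

lemma cmon (a b d i j k : ℕ) : S.c a b d (x ^ i * (y ^ j * z ^ k)) =
    if a = i ∧ b = j ∧ d = k then 1 else 0 := by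
  rw [show x ^ i * (y ^ j * z ^ k) = x ^ i * (y ^ j * (z ^ k * 1)) by ring]
  simp only [cxp, cyp, czp, c_one]
  split_ifs <;> first | rfl | omega
end CoordSys

abbrev JJ {R : Type*} [CommRing R] (x y z : R) (p q r : ℕ) : Ideal R :=
  Ideal.span {(p : R) * x ^ (p - 1) + y * z, (q : R) * y ^ (q - 1) + x * z,
    (r : R) * z ^ (r - 1) + x * y}

section
variable {R : Type*} [CommRing R] [Algebra ℂ R] {x y z : R}

lemma descend {p q r : ℕ} (φ : R →ₗ[ℂ] ℂ)
    (h1 : ∀ g, (p : ℂ) * φ (x ^ (p - 1) * g) + φ (y * (z * g)) = 0)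
    (h2 : ∀ g, (q : ℂ) * φ (y ^ (q - 1) * g) + φ (x * (z * g)) = 0)
    (h3 : ∀ g, (r : ℂ) * φ (z ^ (r - 1) * g) + φ (x * (y * g)) = 0) :
    ∃ φ' : (R ⧸ JJ x y z p q r) →ₗ[ℂ] ℂ, ∀ g, φ' (Ideal.Quotient.mk _ g) = φ g := by
  have hk : ∀ g ∈ JJ x y z p q r, φ g = 0 := by
    intro g hg
    rw [JJ, Ideal.span, Submodule.mem_span_triple] at hg
    obtain ⟨a, b, d, rfl⟩ := hg
    have key : ∀ (n : ℕ) (u v w a : R), φ (a • ((n : R) * u + v * w)) =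
        n * φ (u * a) + φ (v * (w * a)) := by
      intro n u v w a
      rw [show a • ((n : R) * u + v * w) = n • (u * a) + v * (w * a) by
        rw [nsmul_eq_mul, smul_eq_mul]; ring]
      rw [map_add, map_nsmul, nsmul_eq_mul]
    rw [map_add, map_add, key, key, key, h1, h2, h3]; simp
  exact ⟨(Submodule.liftQ ((JJ x y z p q r).restrictScalars ℂ) φ hk) ∘ₗ
    (Submodule.Quotient.restrictScalarsEquiv ℂ (JJ x y z p q r)).symm.toLinearMap, fun g => rfl⟩

def LCond (x y z : R) (p q r : ℕ) : Prop := ∃ φ : R →ₗ[ℂ] ℂ, 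
    (∀ g, (p : ℂ) * φ (x ^ (p - 1) * g) + φ (y * (z * g)) = 0) ∧
    (∀ g, (q : ℂ) * φ (y ^ (q - 1) * g) + φ (x * (z * g)) = 0) ∧
    (∀ g, (r : ℂ) * φ (z ^ (r - 1) * g) + φ (x * (y * g)) = 0) ∧
    φ (x ^ p * (y ^ 0 * z ^ 0)) ≠ 0 ∧ φ (x ^ 0 * (y ^ q * z ^ 0)) ≠ 0 ∧
    φ (x ^ 0 * (y ^ 0 * z ^ r)) ≠ 0 ∧
    φ (x ^ (p + 1) * (y ^ 0 * z ^ 0)) = 0 ∧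
    φ (x ^ 1 * (y ^ (q - 1) * z ^ 0)) = 0 ∧ φ (x ^ 1 * (y ^ 0 * z ^ (r - 1))) = 0 ∧
    φ (x ^ p * (y ^ 1 * z ^ 0)) = 0 ∧
    φ (x ^ 0 * (y ^ 1 * z ^ (r - 1))) = 0 ∧ φ (x ^ p * (y ^ 0 * z ^ 1)) = 0

lemma LCond_A (S : CoordSys R x y z) (p q r : ℕ) : LCond x y z (p + 4) (q + 3) (r + 3) := by
  have hp : (p : ℂ) + 4 ≠ 0 := by exact_mod_cast (show p + 4 ≠ 0 by omega)
  have hq : (q : ℂ) + 3 ≠ 0 := by exact_mod_cast (show q + 3 ≠ 0 by omega)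
  have hr : (r : ℂ) + 3 ≠ 0 := by exact_mod_cast (show r + 3 ≠ 0 by omega)
  refine ⟨S.c 1 1 1 - ((p : ℂ) + 4)⁻¹ • S.c (p + 4) 0 0 - ((q : ℂ) + 3)⁻¹ • S.c 0 (q + 3) 0
    - ((r : ℂ) + 3)⁻¹ • S.c 0 0 (r + 3), ?_⟩
  refine ⟨fun g => ?_, fun g => ?_, fun g => ?_, ?_⟩
  · simp [S.cxp, S.cyp, S.czp, S.cx1, S.cy1, S.cz1, hp]
  · simp [S.cxp, S.cyp, S.czp, S.cx1, S.cy1, S.cz1, hq]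
  · simp [S.cxp, S.cyp, S.czp, S.cx1, S.cy1, S.cz1, hr]
  · simp only [LinearMap.sub_apply, LinearMap.smul_apply, S.cmon]
    simp [hp, hq, hr]

lemma LCond_B (S : CoordSys R x y z) (p q : ℕ) : LCond x y z (p + 5) (q + 4) 2 := by
  have hp : (p : ℂ) + 5 ≠ 0 := by exact_mod_cast (show p + 5 ≠ 0 by omega)
  have hq : (q : ℂ) + 4 ≠ 0 := by exact_mod_cast (show q + 4 ≠ 0 by omega)
  refine ⟨S.c 1 1 1 - ((p : ℂ) + 5)⁻¹ • S.c (p + 5) 0 0 - ((q : ℂ) + 4)⁻¹ • S.c 0 (q + 4) 0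
    - (2 : ℂ)⁻¹ • S.c 0 0 2 - (2 : ℂ) • S.c 2 2 0, ?_⟩
  refine ⟨fun g => ?_, fun g => ?_, fun g => ?_, ?_⟩
  · simp [S.cxp, S.cyp, S.czp, S.cx1, S.cy1, S.cz1, hp]
  · simp [S.cxp, S.cyp, S.czp, S.cx1, S.cy1, S.cz1, hq]
  · simp [S.cxp, S.cyp, S.czp, S.cx1, S.cy1, S.cz1]
    ring
  · simp only [LinearMap.sub_apply, LinearMap.smul_apply, S.cmon]
    simp [hp, hq]

lemma LCond_C (S : CoordSys R x y z) (p : ℕ) : LCond x y z (p + 7) 3 2 := by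
  have hp : (p : ℂ) + 7 ≠ 0 := by exact_mod_cast (show p + 7 ≠ 0 by omega)
  refine ⟨S.c 1 1 1 - ((p : ℂ) + 7)⁻¹ • S.c (p + 7) 0 0 - (3 : ℂ)⁻¹ • S.c 0 3 0
    - (2 : ℂ)⁻¹ • S.c 0 0 2 - (2 : ℂ) • S.c 2 2 0 - (12 : ℂ) • S.c 4 1 0 + (6 : ℂ) • S.c 3 0 1, ?_⟩
  refine ⟨fun g => ?_, fun g => ?_, fun g => ?_, ?_⟩
  · simp [S.cxp, S.cyp, S.czp, S.cx1, S.cy1, S.cz1, hp]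
  · simp [S.cxp, S.cyp, S.czp, S.cx1, S.cy1, S.cz1]
    ring
  · simp [S.cxp, S.cyp, S.czp, S.cx1, S.cy1, S.cz1]
    ring
  · simp only [LinearMap.sub_apply, LinearMap.add_apply, LinearMap.smul_apply, S.cmon]
    simp [hp]

lemma functionals_of (S : CoordSys R x y z) (p q r : ℕ) (hp : 2 ≤ p) (hq : 2 ≤ q) (hr : 2 ≤ r) (hL : LCond x y z p q r) :
    Functionals (Ideal.Quotient.mk (JJ x y z p q r) x) (Ideal.Quotient.mk (JJ x y z p q r) y)
      (Ideal.Quotient.mk (JJ x y z p q r) z) p q r := by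
  have ex : ∀ m, x ^ m = x ^ m * (y ^ 0 * z ^ 0) := fun m => by ring
  have ey : ∀ m, y ^ m = x ^ 0 * (y ^ m * z ^ 0) := fun m => by ring
  have ez : ∀ m, z ^ m = x ^ 0 * (y ^ 0 * z ^ m) := fun m => by ring
  refine ⟨?_, ?_, ?_, ?_⟩
  · intro n hn
    obtain ⟨φ, hφ⟩ := descend (p := p) (q := q) (r := r) (x := x) (y := y) (z := z) (S.c n 0 0)
      (fun g => by simp [S.cxp, S.cy1, show ¬ (p - 1 ≤ n) by omega])
      (fun g => by simp [S.cyp, S.cx1, S.cz1, show ¬ (q - 1 ≤ 0) by omega])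
      (fun g => by simp [S.czp, S.cx1, S.cy1, show ¬ (r - 1 ≤ 0) by omega])
    refine ⟨φ, fun m => ?_, fun m => ?_, fun m => ?_⟩
    · rw [← map_pow, hφ, ex, S.cmon]; simp [eq_comm]
    · rw [← map_pow, hφ, ey, S.cmon]; simp
    · rw [← map_pow, hφ, ez, S.cmon]; simp
  · intro n hn
    obtain ⟨φ, hφ⟩ := descend (p := p) (q := q) (r := r) (x := x) (y := y) (z := z) (S.c 0 (n + 1) 0)
      (fun g => by simp [S.cxp, S.cy1, S.cz1, show ¬ (p - 1 ≤ 0) by omega])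
      (fun g => by simp [S.cyp, S.cx1, S.cz1, show ¬ (q - 1 ≤ n + 1) by omega])
      (fun g => by simp [S.czp, S.cx1, S.cy1, show ¬ (r - 1 ≤ 0) by omega])
    refine ⟨φ, fun m => ?_, fun m => ?_, fun m => ?_⟩
    · rw [← map_pow, hφ, ex, S.cmon]; simp
    · rw [← map_pow, hφ, ey, S.cmon]; simp [eq_comm]
    · rw [← map_pow, hφ, ez, S.cmon]; simp
  · intro n hn
    obtain ⟨φ, hφ⟩ := descend (p := p) (q := q) (r := r) (x := x) (y := y) (z := z) (S.c 0 0 (n + 1))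
      (fun g => by simp [S.cxp, S.cy1, S.cz1, show ¬ (p - 1 ≤ 0) by omega])
      (fun g => by simp [S.cyp, S.cx1, S.cz1, show ¬ (q - 1 ≤ 0) by omega])
      (fun g => by simp [S.czp, S.cx1, S.cy1, show ¬ (r - 1 ≤ n + 1) by omega])
    refine ⟨φ, fun m => ?_, fun m => ?_, fun m => ?_⟩
    · rw [← map_pow, hφ, ex, S.cmon]; simp
    · rw [← map_pow, hφ, ey, S.cmon]; simp
    · rw [← map_pow, hφ, ez, S.cmon]; simp [eq_comm]
  · obtain ⟨L, k1, k2, k3, l1, l2, l3, l4, l5, l6, l7, l8, l9⟩ := hL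
    obtain ⟨φ, hφ⟩ := descend L k1 k2 k3
    refine ⟨φ, ?_, ?_, ?_, ?_, ?_, ?_, ?_, ?_, ?_⟩ <;>
      simp only [← map_pow, ← map_mul, hφ]
    · rwa [ex]
    · rwa [ey]
    · rwa [ez]
    · rwa [ex]
    · simpa using l5
    · simpa using l6
    · simpa [mul_comm] using l7
    · simpa using l8
    · simpa [mul_comm] using l9

lemma main_of (S : CoordSys R x y z) (p q r : ℕ) (hp : 2 ≤ p) (hq : 2 ≤ q) (hr : 2 ≤ r)
    (h : (1 : ℚ) / p + 1 / q + 1 / r < 1) (hL : LCond x y z p q r)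
    (C : ClosedFacts (Ideal.Quotient.mk (JJ x y z p q r) x) (Ideal.Quotient.mk (JJ x y z p q r) y)
      (Ideal.Quotient.mk (JJ x y z p q r) z) (p : R ⧸ JJ x y z p q r) (q : R ⧸ JJ x y z p q r)
      (r : R ⧸ JJ x y z p q r)) :
    Module.finrank ℂ (R ⧸ JJ x y z p q r) = p + q + r - 1 ∧
    Module.finrank ℂ (R ⧸ Ideal.span {x ^ p + y ^ q + z ^ r + x * y * z,
      (p : R) * x ^ (p - 1) + y * z, (q : R) * y ^ (q - 1) + x * z,
      (r : R) * z ^ (r - 1) + x * y}) = p + q + r - 2 := by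
  have F := functionals_of S p q r hp hq hr hL
  have hdecR := S.dec
  set J := JJ x y z p q r with hJ
  set π := Ideal.Quotient.mk J with hπ
  have e1 : (p : R ⧸ J) * π x ^ (p - 1) + π y * π z = 0 := by
    have : π ((p : R) * x ^ (p - 1) + y * z) = 0 :=
      Ideal.Quotient.eq_zero_iff_mem.mpr (Ideal.subset_span (by simp))
    simpa using this
  have e2 : (q : R ⧸ J) * π y ^ (q - 1) + π x * π z = 0 := by
    have : π ((q : R) * y ^ (q - 1) + x * z) = 0 :=
      Ideal.Quotient.eq_zero_iff_mem.mpr (Ideal.subset_span (by simp))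
    simpa using this
  have e3 : (r : R ⧸ J) * π z ^ (r - 1) + π x * π y = 0 := by
    have : π ((r : R) * z ^ (r - 1) + x * y) = 0 :=
      Ideal.Quotient.eq_zero_iff_mem.mpr (Ideal.subset_span (by simp))
    simpa using this
  have hinv : ∀ n : ℕ, 2 ≤ n → ∀ v w : R ⧸ J, (n : R ⧸ J) * v = w → v = ((n : ℂ)⁻¹) • w := by
    rintro n hn v w rfl
    rw [← nsmul_eq_mul, ← Nat.cast_smul_eq_nsmul ℂ, smul_smul, inv_mul_cancel₀, one_smul]
    exact Nat.cast_ne_zero.mpr (by omega)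
  have hpow : ∀ (n : ℕ) (u : R ⧸ J), 2 ≤ n → u ^ n = u * u ^ (n - 1) := by
    intro n u hn
    rw [← pow_succ', Nat.sub_add_cancel (by omega)]
  set s := π x * π y * π z with hs
  have xp : π x ^ p = ((p : ℂ)⁻¹) • (-s) := hinv p hp _ _ (by
    rw [hpow p _ hp, hs]; linear_combination π x * e1)
  have yq : π y ^ q = ((q : ℂ)⁻¹) • (-s) := hinv q hq _ _ (by
    rw [hpow q _ hq, hs]; linear_combination π y * e2)
  have zr : π z ^ r = ((r : ℂ)⁻¹) • (-s) := hinv r hr _ _ (by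
    rw [hpow r _ hr, hs]; linear_combination π z * e3)
  have nx : IsNilpotent (π x) := ⟨p + 1, by
    rw [pow_succ', xp, mul_smul_comm, mul_neg, hs, C.zx]; simp⟩
  have ny : IsNilpotent (π y) := ⟨q + 1, by
    rw [pow_succ', yq, mul_smul_comm, mul_neg, hs, C.zy]; simp⟩
  have nz : IsNilpotent (π z) := ⟨r + 1, by
    rw [pow_succ', zr, mul_smul_comm, mul_neg, hs, C.zz]; simp⟩
  have hdec : ∀ g : R ⧸ J, ∃ (t : ℂ) (g1 g2 g3 : R ⧸ J),
      g = algebraMap ℂ (R ⧸ J) t + π x * g1 + π y * g2 + π z * g3 := by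
    intro g
    obtain ⟨g, rfl⟩ := Ideal.Quotient.mk_surjective g
    obtain ⟨t, g1, g2, g3, hg⟩ := hdecR g
    refine ⟨t, π g1, π g2, π g3, ?_⟩
    rw [hg]
    simp only [map_add, map_mul]
    rfl
  have hsurj := Phi_surj p q r hp hq hr e1 e2 e3 C (gen_of_dec hdec nx ny nz)
  have hinj := Phi_inj p q r hp hq hr F
  let E := LinearEquiv.ofBijective _ ⟨hinj, hsurj⟩
  have hfin : Module.Finite ℂ (R ⧸ J) := Module.Finite.equiv E
  have hμ : Module.finrank ℂ (R ⧸ J) = p + q + r - 1 := by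
    rw [← E.finrank_eq]
    simp
    omega
  refine ⟨hμ, ?_⟩
  have hs0 : s ≠ 0 := by
    intro h0
    obtain ⟨L, Lx, -⟩ := F.fL
    apply Lx
    rw [xp, h0]; simp
  set f := x ^ p + y ^ q + z ^ r + x * y * z with hf
  set I : Ideal R := Ideal.span {f,
      (p : R) * x ^ (p - 1) + y * z, (q : R) * y ^ (q - 1) + x * z,
      (r : R) * z ^ (r - 1) + x * y} with hI
  have hJI : J ≤ I := Ideal.span_mono (Set.subset_insert _ _)
  let κ : ℂ := 1 - (p : ℂ)⁻¹ - (q : ℂ)⁻¹ - (r : ℂ)⁻¹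
  have hκ : κ ≠ 0 := by
    have h' : (1 : ℚ) - (p : ℚ)⁻¹ - (q : ℚ)⁻¹ - (r : ℚ)⁻¹ ≠ 0 := by
      simp only [one_div] at h
      intro h0; linarith
    have : κ = (((1 : ℚ) - (p : ℚ)⁻¹ - (q : ℚ)⁻¹ - (r : ℚ)⁻¹ : ℚ) : ℂ) := by
      simp [κ]
    rw [this]; exact_mod_cast h'
  have hfs : π f = κ • s := by
    simp only [hf, map_add, map_pow, map_mul]
    rw [xp, yq, zr, ← hs]
    simp only [κ, sub_smul, smul_neg, one_smul]
    abel
  let T : (R ⧸ J) →ₗ[ℂ] (R ⧸ I) := (Ideal.Quotient.factorₐ ℂ hJI).toLinearMap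
  have hT : ∀ g, T (π g) = Ideal.Quotient.mk I g := fun g => rfl
  have hTs : LinearMap.range T = ⊤ := by
    rw [LinearMap.range_eq_top]
    intro g
    obtain ⟨g, rfl⟩ := Ideal.Quotient.mk_surjective g
    exact ⟨π g, rfl⟩
  have hker : LinearMap.ker T = Submodule.span ℂ {s} := by
    apply le_antisymm
    · intro g hg
      obtain ⟨g, rfl⟩ := Ideal.Quotient.mk_surjective g
      rw [LinearMap.mem_ker, hT, Ideal.Quotient.eq_zero_iff_mem, hI, Ideal.mem_span_insert] at hg
      obtain ⟨a, j, hj, rfl⟩ := hg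
      have hj' : π j = 0 := Ideal.Quotient.eq_zero_iff_mem.mpr hj
      obtain ⟨t, g1, g2, g3, ha⟩ := hdec (π a)
      rw [Submodule.mem_span_singleton]
      refine ⟨t * κ, ?_⟩
      rw [map_add, map_mul, hj', add_zero, ha, hfs, mul_smul_comm,
        show (algebraMap ℂ (R ⧸ J) t + π x * g1 + π y * g2 + π z * g3) * s
          = algebraMap ℂ (R ⧸ J) t * s by
          linear_combination g1 * C.zx + g2 * C.zy + g3 * C.zz,
        ← Algebra.smul_def, smul_smul, mul_comm]
    · rw [Submodule.span_singleton_le_iff_mem, LinearMap.mem_ker]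
      have : T (κ • s) = 0 := by
        rw [← hfs, hT]
        exact Ideal.Quotient.eq_zero_iff_mem.mpr (Ideal.subset_span (by simp))
      rw [map_smul] at this
      exact (smul_eq_zero.mp this).resolve_left hκ
  have hrn := LinearMap.finrank_range_add_finrank_ker T
  rw [hTs, hker, finrank_top, finrank_span_singleton hs0, hμ] at hrn
  omega

lemma main_sorted (S : CoordSys R x y z) (p q r : ℕ) (hr : 2 ≤ r) (hrq : r ≤ q) (hqp : q ≤ p)
    (h : (1 : ℚ) / p + 1 / q + 1 / r < 1) :
    Module.finrank ℂ (R ⧸ JJ x y z p q r) = p + q + r - 1 ∧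
    Module.finrank ℂ (R ⧸ Ideal.span {x ^ p + y ^ q + z ^ r + x * y * z,
      (p : R) * x ^ (p - 1) + y * z, (q : R) * y ^ (q - 1) + x * z,
      (r : R) * z ^ (r - 1) + x * y}) = p + q + r - 2 := by
  set J := JJ x y z p q r with hJ
  set π := Ideal.Quotient.mk J with hπ
  have e1 : (p : R ⧸ J) * π x ^ (p - 1) + π y * π z = 0 := by
    have : π ((p : R) * x ^ (p - 1) + y * z) = 0 :=
      Ideal.Quotient.eq_zero_iff_mem.mpr (Ideal.subset_span (by simp))
    simpa using this
  have e2 : (q : R ⧸ J) * π y ^ (q - 1) + π x * π z = 0 := by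
    have : π ((q : R) * y ^ (q - 1) + x * z) = 0 :=
      Ideal.Quotient.eq_zero_iff_mem.mpr (Ideal.subset_span (by simp))
    simpa using this
  have e3 : (r : R ⧸ J) * π z ^ (r - 1) + π x * π y = 0 := by
    have : π ((r : R) * z ^ (r - 1) + x * y) = 0 :=
      Ideal.Quotient.eq_zero_iff_mem.mpr (Ideal.subset_span (by simp))
    simpa using this
  have hloc : ∀ e a : R ⧸ J, e = e * (π x * a) → e = 0 := by
    intro e a he
    obtain ⟨a, rfl⟩ := Ideal.Quotient.mk_surjective a
    have hu := (S.ux a).map π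
    have : e * π (1 - x * a) = 0 := by
      rw [map_sub, map_one, map_mul, mul_sub, mul_one, ← he, sub_self]
    exact (hu.mul_left_eq_zero).mp this
  have hcases : (3 ≤ r ∧ 4 ≤ p) ∨ (r = 2 ∧ 4 ≤ q ∧ 5 ≤ p) ∨ (r = 2 ∧ q = 3 ∧ 7 ≤ p) := by
    have hr0 : (0 : ℚ) < r := by exact_mod_cast (show 0 < r by omega)
    have hq0 : (0 : ℚ) < q := by exact_mod_cast (show 0 < q by omega)
    have hp0 : (0 : ℚ) < p := by exact_mod_cast (show 0 < p by omega)
    have h' : q * r + p * r + p * q < p * q * r := by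
      have : (1 : ℚ) / p + 1 / q + 1 / r = (q * r + p * r + p * q) / (p * q * r) := by
        field_simp
      rw [this, div_lt_one (by positivity)] at h
      exact_mod_cast h
    by_contra hc
    push Not at hc
    obtain ⟨c1, c2, c3⟩ := hc
    by_cases hr3 : 3 ≤ r
    · have := c1 hr3
      have hp3 : p = 3 := by omega
      have hq3 : q = 3 := by omega
      have hr3 : r = 3 := by omega
      subst hp3 hq3 hr3
      omega
    · have hr2 : r = 2 := by omega
      subst hr2
      by_cases hq4 : 4 ≤ q
      · have := c2 rfl hq4
        have hp3 : p = 4 := by omega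
        have hq3 : q = 4 := by omega
        subst hp3 hq3
        omega
      · have : q = 2 ∨ q = 3 := by omega
        rcases this with rfl | rfl
        · omega
        · have := c3 rfl rfl
          omega
  rcases hcases with ⟨h3, h4⟩ | ⟨rfl, h4, h5⟩ | ⟨rfl, rfl, h7⟩
  · obtain ⟨p, rfl⟩ := Nat.exists_eq_add_of_le' h4
    obtain ⟨q, rfl⟩ := Nat.exists_eq_add_of_le' (show 3 ≤ q by omega)
    obtain ⟨r, rfl⟩ := Nat.exists_eq_add_of_le' h3
    exact main_of S _ _ _ (by omega) (by omega) (by omega) h (LCond_A S p q r)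
      (caseA_facts p q r hloc e1 e2 e3)
  · obtain ⟨p, rfl⟩ := Nat.exists_eq_add_of_le' h5
    obtain ⟨q, rfl⟩ := Nat.exists_eq_add_of_le' h4
    exact main_of S _ _ _ (by omega) (by omega) (by omega) h (LCond_B S p q)
      (caseB_facts p q hloc e1 e2 (by simpa using e3))
  · obtain ⟨p, rfl⟩ := Nat.exists_eq_add_of_le' h7
    exact main_of S _ _ _ (by omega) (by omega) (by omega) h (LCond_C S p)
      (caseC_facts p hloc e1 (by simpa using e2) (by simpa using e3))

/-- The conclusion of the theorem for given coordinates. -/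
def Concl (x y z : R) (p q r : ℕ) : Prop :=
  Module.finrank ℂ (R ⧸ JJ x y z p q r) = p + q + r - 1 ∧
    Module.finrank ℂ (R ⧸ Ideal.span {x ^ p + y ^ q + z ^ r + x * y * z,
      (p : R) * x ^ (p - 1) + y * z, (q : R) * y ^ (q - 1) + x * z,
      (r : R) * z ^ (r - 1) + x * y}) = p + q + r - 2

lemma Concl.swap12 {p q r : ℕ} (h : Concl y x z q p r) : Concl x y z p q r := by
  unfold Concl JJ at *
  rw [show p + q + r = q + p + r by ring]
  have h2 : y ^ q + x ^ p + z ^ r + y * x * z = x ^ p + y ^ q + z ^ r + x * y * z := by ring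
  rw [Set.insert_comm, h2, mul_comm y x] at h
  exact h

lemma Concl.swap23 {p q r : ℕ} (h : Concl x z y p r q) : Concl x y z p q r := by
  unfold Concl JJ at *
  rw [show p + q + r = p + r + q by ring]
  have h2 : x ^ p + z ^ r + y ^ q + x * z * y = x ^ p + y ^ q + z ^ r + x * y * z := by ring
  rw [Set.pair_comm, h2, mul_comm z y] at h
  exact h

lemma main_all (S : CoordSys R x y z) (p q r : ℕ) (hp : 2 ≤ p) (hq : 2 ≤ q) (hr : 2 ≤ r)
    (h : (1 : ℚ) / p + 1 / q + 1 / r < 1) : Concl x y z p q r := by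
  rcases le_total p q with a | a <;> rcases le_total q r with b | b <;>
    rcases le_total p r with d | d
  · exact Concl.swap12 (Concl.swap23 (Concl.swap12
      (main_sorted S.swap12.swap23.swap12 r q p hp a b (by linarith))))
  · exact Concl.swap12 (Concl.swap23 (Concl.swap12
      (main_sorted S.swap12.swap23.swap12 r q p hp a b (by linarith))))
  · exact Concl.swap12 (Concl.swap23 (main_sorted S.swap12.swap23 q r p hp d b (by linarith)))
  · exact Concl.swap12 (main_sorted S.swap12 q p r hr d a (by linarith))
  · exact Concl.swap23 (Concl.swap12 (main_sorted S.swap23.swap12 r p q hq a d (by linarith)))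
  · exact Concl.swap23 (main_sorted S.swap23 p r q hq b d (by linarith))
  · exact main_sorted S p q r hr b a h
  · exact main_sorted S p q r hr b a h
end

open MvPowerSeries

noncomputable def psSys : CoordSys (MvPowerSeries (Fin 3) ℂ) (X 0) (X 1) (X 2) where
  c a b d := coeff (Finsupp.single 0 a + Finsupp.single 1 b + Finsupp.single 2 d)
  c_one a b d := by
    classical
    rw [coeff_one]
    congr 1
    simp only [eq_iff_iff, add_eq_zero, Finsupp.single_eq_zero]
    tauto
  cx a b d g := by
    rw [show (Finsupp.single 0 (a + 1) + Finsupp.single 1 b + Finsupp.single 2 d : Fin 3 →₀ ℕ)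
      = Finsupp.single 0 1 + (Finsupp.single 0 a + Finsupp.single 1 b + Finsupp.single 2 d) by
      rw [Finsupp.single_add]; abel, X, coeff_add_monomial_mul, one_mul]
  cx0 b d g := by
    rw [X, coeff_monomial_mul, if_neg]
    intro h
    simpa using h 0
  cy a b d g := by
    rw [show (Finsupp.single 0 a + Finsupp.single 1 (b + 1) + Finsupp.single 2 d : Fin 3 →₀ ℕ)
      = Finsupp.single 1 1 + (Finsupp.single 0 a + Finsupp.single 1 b + Finsupp.single 2 d) by
      rw [Finsupp.single_add]; abel, X, coeff_add_monomial_mul, one_mul]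
  cy0 a d g := by
    rw [X, coeff_monomial_mul, if_neg]
    intro h
    simpa using h 1
  cz a b d g := by
    rw [show (Finsupp.single 0 a + Finsupp.single 1 b + Finsupp.single 2 (d + 1) : Fin 3 →₀ ℕ)
      = Finsupp.single 2 1 + (Finsupp.single 0 a + Finsupp.single 1 b + Finsupp.single 2 d) by
      rw [Finsupp.single_add]; abel, X, coeff_add_monomial_mul, one_mul]
  cz0 a b g := by
    rw [X, coeff_monomial_mul, if_neg]
    intro h
    simpa using h 2
  dec g := by
    classical
    let G1 : MvPowerSeries (Fin 3) ℂ := fun m => if m 0 = 0 then 0 else coeff m g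
    let G2 : MvPowerSeries (Fin 3) ℂ := fun m =>
      if m 1 = 0 then 0 else if m 0 = 0 then coeff m g else 0
    let G3 : MvPowerSeries (Fin 3) ℂ := fun m =>
      if m 2 = 0 then 0 else if m 0 = 0 ∧ m 1 = 0 then coeff m g else 0
    have c1 : ∀ m, coeff m G1 = if m 0 = 0 then 0 else coeff m g := fun m => rfl
    have c2 : ∀ m, coeff m G2 = if m 1 = 0 then 0 else if m 0 = 0 then coeff m g else 0 :=
      fun m => rfl
    have c3 : ∀ m, coeff m G3 =
        if m 2 = 0 then 0 else if m 0 = 0 ∧ m 1 = 0 then coeff m g else 0 := fun m => rfl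
    have d1 : (X 0 : MvPowerSeries (Fin 3) ℂ) ∣ G1 := X_dvd_iff.mpr fun m hm => by simp [c1, hm]
    have d2 : (X 1 : MvPowerSeries (Fin 3) ℂ) ∣ G2 := X_dvd_iff.mpr fun m hm => by simp [c2, hm]
    have d3 : (X 2 : MvPowerSeries (Fin 3) ℂ) ∣ G3 := X_dvd_iff.mpr fun m hm => by simp [c3, hm]
    obtain ⟨g1, h1⟩ := d1
    obtain ⟨g2, h2⟩ := d2
    obtain ⟨g3, h3⟩ := d3
    refine ⟨coeff 0 g, g1, g2, g3, ?_⟩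
    rw [← h1, ← h2, ← h3]
    ext m
    have hm : m = 0 ↔ m 0 = 0 ∧ m 1 = 0 ∧ m 2 = 0 := by
      rw [Finsupp.ext_iff]; simp [Fin.forall_fin_succ]
    simp only [map_add, c1, c2, c3, MvPowerSeries.algebraMap_apply, Algebra.algebraMap_self, RingHom.id_apply,
      coeff_C]
    by_cases k0 : m 0 = 0 <;> by_cases k1 : m 1 = 0 <;> by_cases k2 : m 2 = 0 <;>
      simp [hm, k0, k1, k2]
    rw [hm.mpr ⟨k0, k1, k2⟩]; rfl
  ux a := by rw [isUnit_iff_constantCoeff]; simp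
  uy a := by rw [isUnit_iff_constantCoeff]; simp
  uz a := by rw [isUnit_iff_constantCoeff]; simp



/-- For the hyperbolic singularity `T_{p,q,r} : f = x^p + y^q + z^r + xyz` with
`1/p + 1/q + 1/r < 1`, the Milnor number is `μ(f) = p + q + r - 1` and the Tjurina
number is `τ(f) = p + q + r - 2`. -/
theorem milnor_tjurina_of_hyperbolic (p q r : ℕ) (hp : 2 ≤ p) (hq : 2 ≤ q) (hr : 2 ≤ r)
    (h : (1 : ℚ) / p + 1 / q + 1 / r < 1) :
    Module.finrank ℂ (MvPowerSeries (Fin 3) ℂ ⧸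
        (Ideal.span {(p : MvPowerSeries (Fin 3) ℂ) * X 0 ^ (p - 1) + X 1 * X 2,
          (q : MvPowerSeries (Fin 3) ℂ) * X 1 ^ (q - 1) + X 0 * X 2,
          (r : MvPowerSeries (Fin 3) ℂ) * X 2 ^ (r - 1) + X 0 * X 1})) = p + q + r - 1 ∧
    Module.finrank ℂ (MvPowerSeries (Fin 3) ℂ ⧸
        (Ideal.span {X 0 ^ p + X 1 ^ q + X 2 ^ r + X 0 * X 1 * X 2,
          (p : MvPowerSeries (Fin 3) ℂ) * X 0 ^ (p - 1) + X 1 * X 2,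
          (q : MvPowerSeries (Fin 3) ℂ) * X 1 ^ (q - 1) + X 0 * X 2,
          (r : MvPowerSeries (Fin 3) ℂ) * X 2 ^ (r - 1) + X 0 * X 1})) = p + q + r - 2 := by
  exact main_all psSys p q r hp hq hr h
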